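/- arXiv:1404.7582 — 3 statements merged into one kernel-verified Lean document; each statement's English description precedes it below -/
import Mathlib

section
/- Sewing lemma: Let (B, ‖·‖) be a Banach space, a < b real numbers, ε > 0 and K ≥ 0. Let μ : [a,b]² → B be a continuous function satisfying ‖μ(s,t) − μ(s,c) − μ(c,t)‖ ≤ K|t−s|^{1+ε} for all a ≤ s ≤ c ≤ t ≤ b. Then there exists a function 𝒥μ : [a,b] → B, unique up to an additive constant, such that ‖𝒥μ(t) − 𝒥μ(s) − μ(s,t)‖ ≤ K(1 − 2^{−ε})^{−1}|t−s|^{1+ε} for all a ≤ s ≤ t ≤ b. Moreover, for partitions π = {a = t₀ < t₁ < ⋯ < t_m = b} the Riemann sums Σ_{i=0}^{m−1} μ(t_i, t_{i+1}) converge to 𝒥μ(b) − 𝒥μ(a) as the mesh |π| = max_i (t_{i+1} − t_i) tends to 0. -/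
open scoped BigOperators

noncomputable section

/-- `t : Fin (m+1) → ℝ` is a partition `a = t₀ < t₁ < ⋯ < t_m = b` of `[a,b]`. -/
def IsPartition (a b : ℝ) (m : ℕ) (t : Fin (m + 1) → ℝ) : Prop :=
  StrictMono t ∧ t 0 = a ∧ t (Fin.last m) = b

/-- The mesh `|π| = max_i (t_{i+1} - t_i)` of a partition. -/
def partMesh (m : ℕ) (t : Fin (m + 1) → ℝ) : ℝ :=
  ⨆ i : Fin m, (t i.succ - t i.castSucc)

/-- The Riemann sums `Σ_{i=0}^{m-1} μ(t_i, t_{i+1})` over partitions of `[a,b]`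
converge to `I` as the mesh tends to `0`. -/
def RiemannLimit {B : Type*} [NormedAddCommGroup B] (a b : ℝ) (μ : ℝ → ℝ → B) (I : B) : Prop :=
  ∀ ε : ℝ, 0 < ε → ∃ δ : ℝ, 0 < δ ∧ ∀ (m : ℕ) (t : Fin (m + 1) → ℝ),
    IsPartition a b m t → partMesh m t < δ →
    ‖(∑ i : Fin m, μ (t i.castSucc) (t i.succ)) - I‖ < ε

lemma sew_half (ε : ℝ) (x : ℝ) (hx : 0 ≤ x) :
    (x / 2) ^ (1 + ε) = (2 : ℝ) ^ (-ε) / 2 * x ^ (1 + ε) := by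
  rw [Real.div_rpow hx (by norm_num), Real.rpow_add (by norm_num : (0:ℝ) < 2), Real.rpow_one,
    Real.rpow_neg (by norm_num)]
  field_simp

lemma sew_r_lt (ε : ℝ) (hε : 0 < ε) : (2 : ℝ) ^ (-ε) < 1 :=
  Real.rpow_lt_one_of_one_lt_of_neg (by norm_num) (by linarith)

lemma sew_unique {B : Type*} [NormedAddCommGroup B]
    (a b : ℝ) (ε : ℝ) (hε : 0 < ε) (C : ℝ) (D : ℝ → ℝ → B)
    (hmid : ∀ s t, a ≤ s → s ≤ t → t ≤ b → D s t = D s ((s + t) / 2) + D ((s + t) / 2) t)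
    (hb : ∀ s t, a ≤ s → s ≤ t → t ≤ b → ‖D s t‖ ≤ C * (t - s) ^ (1 + ε)) :
    ∀ s t, a ≤ s → s ≤ t → t ≤ b → D s t = 0 := by
  have key : ∀ n : ℕ, ∀ s t, a ≤ s → s ≤ t → t ≤ b →
      ‖D s t‖ ≤ C * (t - s) ^ (1 + ε) * ((2 : ℝ) ^ (-ε)) ^ n := by
    intro n
    induction n with
    | zero => intro s t h1 h2 h3; simpa using hb s t h1 h2 h3
    | succ n ih =>
      intro s t h1 h2 h3
      have e1 := ih s ((s + t) / 2) h1 (by linarith) (by linarith)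
      have e2 := ih ((s + t) / 2) t (by linarith) (by linarith) h3
      rw [show (s + t) / 2 - s = (t - s) / 2 by ring, sew_half ε _ (by linarith)] at e1
      rw [show t - (s + t) / 2 = (t - s) / 2 by ring, sew_half ε _ (by linarith)] at e2
      rw [hmid s t h1 h2 h3]
      refine (norm_add_le _ _).trans ?_
      rw [pow_succ]
      linarith
  intro s t h1 h2 h3
  have hl : Filter.Tendsto (fun n : ℕ => C * (t - s) ^ (1 + ε) * ((2 : ℝ) ^ (-ε)) ^ n)
      Filter.atTop (nhds (C * (t - s) ^ (1 + ε) * 0)) :=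
    (tendsto_pow_atTop_nhds_zero_of_lt_one (by positivity) (sew_r_lt ε hε)).const_mul _
  rw [mul_zero] at hl
  have := ge_of_tendsto' hl (fun n => key n s t h1 h2 h3)
  exact norm_le_zero_iff.1 this

/-- Dyadic Riemann sums. -/
def sewS {B : Type*} [NormedAddCommGroup B] (μ : ℝ → ℝ → B) : ℕ → ℝ → ℝ → B
  | 0 => μ
  | n + 1 => fun s t => sewS μ n s ((s + t) / 2) + sewS μ n ((s + t) / 2) t

lemma sewS_diff {B : Type*} [NormedAddCommGroup B]
    (a b : ℝ) (ε : ℝ) (K : ℝ) (μ : ℝ → ℝ → B)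
    (hμ : ∀ s c t : ℝ, a ≤ s → s ≤ c → c ≤ t → t ≤ b →
      ‖μ s t - μ s c - μ c t‖ ≤ K * (t - s) ^ (1 + ε)) (n : ℕ) :
    ∀ s t, a ≤ s → s ≤ t → t ≤ b →
      dist (sewS μ n s t) (sewS μ (n + 1) s t) ≤
        K * (t - s) ^ (1 + ε) * ((2 : ℝ) ^ (-ε)) ^ n := by
  induction n with
  | zero =>
    intro s t h1 h2 h3
    have := hμ s ((s + t) / 2) t h1 (by linarith) (by linarith) h3
    simpa [sewS, dist_eq_norm, sub_sub] using this
  | succ n ih =>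
    intro s t h1 h2 h3
    have e1 := ih s ((s + t) / 2) h1 (by linarith) (by linarith)
    have e2 := ih ((s + t) / 2) t (by linarith) (by linarith) h3
    rw [show (s + t) / 2 - s = (t - s) / 2 by ring, sew_half ε _ (by linarith)] at e1
    rw [show t - (s + t) / 2 = (t - s) / 2 by ring, sew_half ε _ (by linarith)] at e2
    change dist (sewS μ n s ((s + t) / 2) + sewS μ n ((s + t) / 2) t)
      (sewS μ (n + 1) s ((s + t) / 2) + sewS μ (n + 1) ((s + t) / 2) t) ≤ _
    refine (dist_add_add_le _ _ _ _).trans ?_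
    rw [pow_succ]
    linarith

lemma sewS_cont {B : Type*} [NormedAddCommGroup B]
    (a b : ℝ) (μ : ℝ → ℝ → B)
    (hcont : ContinuousOn (fun p : ℝ × ℝ => μ p.1 p.2) (Set.Icc a b ×ˢ Set.Icc a b)) (n : ℕ) :
    ContinuousOn (fun p : ℝ × ℝ => sewS μ n p.1 p.2) (Set.Icc a b ×ˢ Set.Icc a b) := by
  induction n with
  | zero => exact hcont
  | succ n ih =>
    have c1 : ContinuousOn (fun p : ℝ × ℝ => sewS μ n p.1 ((p.1 + p.2) / 2))
        (Set.Icc a b ×ˢ Set.Icc a b) := by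
      refine ih.comp (f := fun p : ℝ × ℝ => (p.1, (p.1 + p.2) / 2)) (by fun_prop) ?_
      rintro ⟨x, y⟩ ⟨⟨h1, h2⟩, ⟨h3, h4⟩⟩
      simp only at h1 h2 h3 h4
      exact ⟨⟨h1, h2⟩, ⟨by simp only; linarith, by simp only; linarith⟩⟩
    have c2 : ContinuousOn (fun p : ℝ × ℝ => sewS μ n ((p.1 + p.2) / 2) p.2)
        (Set.Icc a b ×ˢ Set.Icc a b) := by
      refine ih.comp (f := fun p : ℝ × ℝ => ((p.1 + p.2) / 2, p.2)) (by fun_prop) ?_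
      rintro ⟨x, y⟩ ⟨⟨h1, h2⟩, ⟨h3, h4⟩⟩
      simp only at h1 h2 h3 h4
      exact ⟨⟨by simp only; linarith, by simp only; linarith⟩, ⟨h3, h4⟩⟩
    exact c1.add c2

lemma sew_exists {B : Type*} [NormedAddCommGroup B] [CompleteSpace B]
    (a b : ℝ) (ε : ℝ) (hε : 0 < ε) (K : ℝ) (hK : 0 ≤ K) (μ : ℝ → ℝ → B)
    (hcont : ContinuousOn (fun p : ℝ × ℝ => μ p.1 p.2) (Set.Icc a b ×ˢ Set.Icc a b))
    (hμ : ∀ s c t : ℝ, a ≤ s → s ≤ c → c ≤ t → t ≤ b →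
      ‖μ s t - μ s c - μ c t‖ ≤ K * (t - s) ^ (1 + ε)) :
    ∃ I : ℝ → ℝ → B,
      (∀ s t, a ≤ s → s ≤ t → t ≤ b → I s t = I s ((s + t) / 2) + I ((s + t) / 2) t) ∧
      (∀ s t, a ≤ s → s ≤ t → t ≤ b →
        ‖I s t - μ s t‖ ≤ K * (1 - (2 : ℝ) ^ (-ε))⁻¹ * (t - s) ^ (1 + ε)) ∧
      ContinuousOn (fun p : ℝ × ℝ => I p.1 p.2) {p | a ≤ p.1 ∧ p.1 ≤ p.2 ∧ p.2 ≤ b} := by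
  have hr := sew_r_lt ε hε
  have hr0 : 0 < (2 : ℝ) ^ (-ε) := by positivity
  have hex : ∀ s t, ∃ l, a ≤ s → s ≤ t → t ≤ b →
      Filter.Tendsto (fun n => sewS μ n s t) Filter.atTop (nhds l) := by
    intro s t
    by_cases h : a ≤ s ∧ s ≤ t ∧ t ≤ b
    · obtain ⟨h1, h2, h3⟩ := h
      obtain ⟨l, hl⟩ := cauchySeq_tendsto_of_complete (cauchySeq_of_le_geometric _ _ hr
        (fun n => sewS_diff a b ε K μ hμ n s t h1 h2 h3))
      exact ⟨l, fun _ _ _ => hl⟩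
    · exact ⟨0, fun h1 h2 h3 => absurd ⟨h1, h2, h3⟩ h⟩
  choose I hI using hex
  refine ⟨I, ?_, ?_, ?_⟩
  · intro s t h1 h2 h3
    have e1 := hI s ((s + t) / 2) h1 (by linarith) (by linarith)
    have e2 := hI ((s + t) / 2) t (by linarith) (by linarith) h3
    exact tendsto_nhds_unique ((Filter.tendsto_add_atTop_iff_nat 1).2 (hI s t h1 h2 h3))
      (e1.add e2)
  · intro s t h1 h2 h3
    have := dist_le_of_le_geometric_of_tendsto₀ _ _ hr
        (fun n => sewS_diff a b ε K μ hμ n s t h1 h2 h3) (hI s t h1 h2 h3)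
    rw [dist_comm, dist_eq_norm] at this
    refine this.trans (le_of_eq ?_)
    rw [div_eq_mul_inv]; ring
  · have hu : TendstoUniformlyOn (fun n (p : ℝ × ℝ) => sewS μ n p.1 p.2)
        (fun p : ℝ × ℝ => I p.1 p.2) Filter.atTop {p | a ≤ p.1 ∧ p.1 ≤ p.2 ∧ p.2 ≤ b} := by
      rw [Metric.tendstoUniformlyOn_iff]
      intro δ hδ
      have hl : Filter.Tendsto (fun n : ℕ => K * |b - a| ^ (1 + ε) * ((2 : ℝ) ^ (-ε)) ^ n /
          (1 - (2 : ℝ) ^ (-ε))) Filter.atTop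
          (nhds (K * |b - a| ^ (1 + ε) * 0 / (1 - (2 : ℝ) ^ (-ε)))) :=
        ((tendsto_pow_atTop_nhds_zero_of_lt_one hr0.le hr).const_mul _).div_const _
      rw [mul_zero, zero_div] at hl
      filter_upwards [hl.eventually_lt_const hδ] with n hn
      rintro ⟨s, t⟩ ⟨h1, h2, h3⟩
      simp only at h1 h2 h3
      have := dist_le_of_le_geometric_of_tendsto _ _ hr
        (fun n => sewS_diff a b ε K μ hμ n s t h1 h2 h3) (hI s t h1 h2 h3) n
      rw [dist_comm]
      refine lt_of_le_of_lt (this.trans ?_) hn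
      have h5 : (t - s) ^ (1 + ε) ≤ |b - a| ^ (1 + ε) :=
        Real.rpow_le_rpow (by linarith) (le_trans (by linarith) (le_abs_self _)) (by linarith)
      have h6 : 0 ≤ 1 - (2 : ℝ) ^ (-ε) := by linarith
      gcongr
    refine hu.continuousOn (Filter.Eventually.of_forall fun n => (sewS_cont a b μ hcont n).mono ?_).frequently
    rintro ⟨s, t⟩ ⟨h1, h2, h3⟩
    simp only at h1 h2 h3
    exact ⟨⟨h1, by simp only; linarith⟩, ⟨by simp only; linarith, h3⟩⟩

lemma sew_pair {B : Type*} [AddCommGroup B] (g : ℕ → B) (k : ℕ) :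
    ∑ i ∈ Finset.range k, (g (2 * i) + g (2 * i + 1)) = ∑ i ∈ Finset.range (k + k), g i := by
  induction k with
  | zero => simp
  | succ k ih =>
    rw [Finset.sum_range_succ, ih, show k + 1 + (k + 1) = k + k + 1 + 1 by ring,
      Finset.sum_range_succ, Finset.sum_range_succ, two_mul]
    abel

lemma sew_equal {B : Type*} [NormedAddCommGroup B]
    (a b : ℝ) (ε : ℝ) (hε : 0 < ε) (C : ℝ) (hC : 0 ≤ C) (I : ℝ → ℝ → B)
    (hmid : ∀ s t, a ≤ s → s ≤ t → t ≤ b → I s t = I s ((s + t) / 2) + I ((s + t) / 2) t)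
    (hI : ∀ s c t : ℝ, a ≤ s → s ≤ c → c ≤ t → t ≤ b →
      ‖I s t - I s c - I c t‖ ≤ C * (t - s) ^ (1 + ε)) (k : ℕ) (hk : 0 < k) :
    ∀ s t, a ≤ s → s ≤ t → t ≤ b →
      ∑ i ∈ Finset.range k, I (s + i * ((t - s) / k)) (s + (i + 1) * ((t - s) / k)) = I s t := by
  have hk' : (0 : ℝ) < k := by exact_mod_cast hk
  have hself : ∀ s, a ≤ s → s ≤ b → I s s = 0 := by
    intro s h1 h2
    have := hmid s s h1 le_rfl h2
    rw [show (s + s) / 2 = s by ring] at this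
    simpa using this
  have := sew_unique a b ε hε (k * C) (fun s t =>
    ∑ i ∈ Finset.range k, I (s + i * ((t - s) / k)) (s + (i + 1) * ((t - s) / k)) - I s t) ?_ ?_
  · intro s t h1 h2 h3
    exact sub_eq_zero.1 (this s t h1 h2 h3)
  · intro s t h1 h2 h3
    try simp only
    have hsum : ∑ i ∈ Finset.range k, I (s + i * ((t - s) / k)) (s + (i + 1) * ((t - s) / k)) =
        ∑ i ∈ Finset.range k, I (s + i * (((s + t) / 2 - s) / k))
          (s + (i + 1) * (((s + t) / 2 - s) / k)) +
        ∑ i ∈ Finset.range k, I ((s + t) / 2 + i * ((t - (s + t) / 2) / k))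
          ((s + t) / 2 + (i + 1) * ((t - (s + t) / 2) / k)) := by
      set g : ℕ → B := fun i => I (s + i * ((t - s) / 2 / k)) (s + (i + 1) * ((t - s) / 2 / k))
        with hg
      have e1 : ∑ i ∈ Finset.range k, I (s + i * (((s + t) / 2 - s) / k))
          (s + (i + 1) * (((s + t) / 2 - s) / k)) = ∑ i ∈ Finset.range k, g i := by
        refine Finset.sum_congr rfl fun i _ => ?_
        rw [hg, show (s + t) / 2 - s = (t - s) / 2 by ring]
      have e2 : ∑ i ∈ Finset.range k, I ((s + t) / 2 + i * ((t - (s + t) / 2) / k))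
          ((s + t) / 2 + (i + 1) * ((t - (s + t) / 2) / k)) =
          ∑ i ∈ Finset.range k, g (k + i) := by
        refine Finset.sum_congr rfl fun i _ => ?_
        simp only [hg]
        congr 1 <;> (push_cast; field_simp; ring)
      rw [e1, e2, ← Finset.sum_range_add, ← sew_pair]
      refine Finset.sum_congr rfl fun i hi => ?_
      have hi' : (i : ℝ) + 1 ≤ k := by exact_mod_cast Finset.mem_range.1 hi
      have hd : 0 ≤ (t - s) / k := div_nonneg (by linarith) hk'.le
      have hd1 : 0 ≤ (i : ℝ) * ((t - s) / k) := by positivity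
      have hd2 : ((i : ℝ) + 1) * ((t - s) / k) ≤ t - s := by
        calc ((i : ℝ) + 1) * ((t - s) / k) ≤ k * ((t - s) / k) := by gcongr
          _ = t - s := by field_simp
      rw [hmid _ _ (by linarith) (by linarith) (by linarith)]
      simp only [hg]
      congr 2 <;> (push_cast; field_simp; try ring)
    rw [hsum, hmid s t h1 h2 h3]
    abel
  · intro s t h1 h2 h3
    try simp only
    have hd : 0 ≤ (t - s) / k := div_nonneg (by linarith) hk'.le
    have key : ∀ j : ℕ, j ≤ k → ‖∑ i ∈ Finset.range j, I (s + i * ((t - s) / k))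
        (s + (i + 1) * ((t - s) / k)) - I s (s + j * ((t - s) / k))‖ ≤
        j * (C * (t - s) ^ (1 + ε)) := by
      intro j
      induction j with
      | zero => intro _; simp [hself s h1 (by linarith)]
      | succ j ih =>
        intro hj
        have ih := ih (by omega)
        have hi' : (j : ℝ) + 1 ≤ k := by exact_mod_cast hj
        have hd1 : 0 ≤ (j : ℝ) * ((t - s) / k) := by positivity
        have hd2 : ((j : ℝ) + 1) * ((t - s) / k) ≤ t - s := by
          calc ((j : ℝ) + 1) * ((t - s) / k) ≤ k * ((t - s) / k) := by gcongr
            _ = t - s := by field_simp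
        have h4 := hI s (s + j * ((t - s) / k)) (s + (j + 1) * ((t - s) / k)) h1 (by linarith)
          (by linarith) (by linarith)
        have h5 : (s + (j + 1) * ((t - s) / k) - s) ^ (1 + ε) ≤ (t - s) ^ (1 + ε) :=
          Real.rpow_le_rpow (by linarith) (by linarith) (by linarith)
        have h6 := mul_le_mul_of_nonneg_left h5 hC
        rw [Finset.sum_range_succ]
        push_cast
        have h7 := norm_sub_le (∑ i ∈ Finset.range j, I (s + i * ((t - s) / k))
          (s + (i + 1) * ((t - s) / k)) - I s (s + j * ((t - s) / k)))
          (I s (s + (j + 1) * ((t - s) / k)) - I s (s + j * ((t - s) / k)) -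
            I (s + j * ((t - s) / k)) (s + (j + 1) * ((t - s) / k)))
        refine (le_of_eq ?_).trans (h7.trans (by linarith))
        congr 1
        abel
    have := key k le_rfl
    rw [show s + k * ((t - s) / k) = t by field_simp; ring] at this
    linarith

lemma sew_additive {B : Type*} [NormedAddCommGroup B]
    (a b : ℝ) (ε : ℝ) (hε : 0 < ε) (C : ℝ) (hC : 0 ≤ C) (I : ℝ → ℝ → B)
    (hmid : ∀ s t, a ≤ s → s ≤ t → t ≤ b → I s t = I s ((s + t) / 2) + I ((s + t) / 2) t)
    (hI : ∀ s c t : ℝ, a ≤ s → s ≤ c → c ≤ t → t ≤ b →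
      ‖I s t - I s c - I c t‖ ≤ C * (t - s) ^ (1 + ε))
    (hcont : ContinuousOn (fun p : ℝ × ℝ => I p.1 p.2) {p | a ≤ p.1 ∧ p.1 ≤ p.2 ∧ p.2 ≤ b}) :
    ∀ s c t : ℝ, a ≤ s → s ≤ c → c ≤ t → t ≤ b → I s t = I s c + I c t := by
  have hself : ∀ s, a ≤ s → s ≤ b → I s s = 0 := by
    intro s h1 h2
    have := hmid s s h1 le_rfl h2
    rw [show (s + s) / 2 = s by ring] at this
    simpa using this
  have hE : ∀ (k : ℕ) (s h : ℝ), a ≤ s → 0 ≤ h → s + k * h ≤ b →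
      ∑ i ∈ Finset.range k, I (s + i * h) (s + (i + 1) * h) = I s (s + k * h) := by
    intro k s h h1 h2 h3
    rcases Nat.eq_zero_or_pos k with rfl | hk
    · simp only [Nat.cast_zero, zero_mul, add_zero] at *
      simp [hself s h1 h3]
    · have hk' : (0 : ℝ) < k := by exact_mod_cast hk
      have := sew_equal a b ε hε C hC I hmid hI k hk s (s + k * h) h1
        (by nlinarith) h3
      rwa [show (s + k * h - s) / k = h by field_simp; ring] at this
  have hQ : ∀ (p q : ℕ) (s h : ℝ), a ≤ s → 0 ≤ h → s + (p + q : ℕ) * h ≤ b →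
      I s (s + (p + q : ℕ) * h) = I s (s + p * h) + I (s + p * h) (s + (p + q : ℕ) * h) := by
    intro p q s h h1 h2 h3
    have hp : 0 ≤ (p : ℝ) * h := by positivity
    have hq : 0 ≤ (q : ℝ) * h := by positivity
    have h3' := h3
    push_cast at h3'
    have e3 := hE q (s + p * h) h (by linarith) h2 (by linarith)
    rw [← hE (p + q) s h h1 h2 h3, ← hE p s h h1 h2 (by linarith), Finset.sum_range_add,
      show s + ((p + q : ℕ) : ℝ) * h = s + p * h + q * h by push_cast; ring, ← e3]
    congr 1
    refine Finset.sum_congr rfl fun i _ => ?_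
    congr 1 <;> (push_cast; ring)
  intro s c t h1 h2 h3 h4
  rcases eq_or_lt_of_le (h2.trans h3) with hst | hst
  · have hc : c = s := by linarith
    subst hc; subst hst
    simp [hself c h1 h4]
  obtain ⟨l, hl⟩ : ∃ l, l = (c - s) / (t - s) := ⟨_, rfl⟩
  have hts : 0 < t - s := by linarith
  have hl0 : 0 ≤ l := by rw [hl]; exact div_nonneg (by linarith) hts.le
  have hl1 : l ≤ 1 := by rw [hl, div_le_one hts]; linarith
  have hlc : s + l * (t - s) = c := by rw [hl]; field_simp; ring
  have hfl : ∀ n : ℕ, ⌊l * (n : ℝ)⌋₊ ≤ n := fun n => Nat.floor_le_of_le (by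
    have : (0 : ℝ) ≤ n := by positivity
    nlinarith)
  set u : ℕ → ℝ := fun n => s + ((⌊l * (n : ℝ)⌋₊ : ℝ) / n) * (t - s) with hu
  have hut : Filter.Tendsto u Filter.atTop (nhds c) := by
    have := (tendsto_nat_floor_mul_div_atTop hl0).comp (tendsto_natCast_atTop_atTop (R := ℝ))
    have := (this.mul_const (t - s)).const_add s
    rw [hlc] at this
    exact this
  have hum : ∀ n, s ≤ u n ∧ u n ≤ t := by
    intro n
    have e1 : (0 : ℝ) ≤ (⌊l * (n : ℝ)⌋₊ : ℝ) / n := by positivity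
    have e2 : (⌊l * (n : ℝ)⌋₊ : ℝ) / n ≤ 1 :=
      div_le_one_of_le₀ (by exact_mod_cast hfl n) (by positivity)
    simp only [hu]
    constructor <;> nlinarith
  have hc1 : Filter.Tendsto (fun n => I s (u n)) Filter.atTop (nhds (I s c)) := by
    have := hcont (s, c) ⟨h1, h2, h3.trans h4⟩
    refine this.tendsto.comp (f := fun n => (s, u n)) (tendsto_nhdsWithin_iff.2
      ⟨tendsto_const_nhds.prodMk_nhds hut, Filter.Eventually.of_forall fun n => ?_⟩)
    exact ⟨h1, (hum n).1, (hum n).2.trans h4⟩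
  have hc2 : Filter.Tendsto (fun n => I (u n) t) Filter.atTop (nhds (I c t)) := by
    have := hcont (c, t) ⟨h1.trans h2, h3, h4⟩
    refine this.tendsto.comp (f := fun n => (u n, t)) (tendsto_nhdsWithin_iff.2
      ⟨hut.prodMk_nhds tendsto_const_nhds, Filter.Eventually.of_forall fun n => ?_⟩)
    exact ⟨h1.trans (hum n).1, (hum n).2, h4⟩
  refine tendsto_nhds_unique (tendsto_const_nhds.congr' ?_) (hc1.add hc2)
  filter_upwards [Filter.eventually_gt_atTop 0] with n hn
  have hn' : (0 : ℝ) < n := by exact_mod_cast hn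
  have e := hQ ⌊l * (n : ℝ)⌋₊ (n - ⌊l * (n : ℝ)⌋₊) s ((t - s) / n) h1 (by positivity)
  rw [Nat.add_sub_cancel' (hfl n), show s + (n : ℝ) * ((t - s) / n) = t by field_simp; ring] at e
  have e' := e h4
  rwa [show s + (⌊l * (n : ℝ)⌋₊ : ℝ) * ((t - s) / n) = u n by simp only [hu]; ring] at e'

lemma sew_riemann {B : Type*} [NormedAddCommGroup B]
    (a b : ℝ) (hab : a < b) (ε : ℝ) (hε : 0 < ε) (C : ℝ) (hC : 0 ≤ C) (μ : ℝ → ℝ → B) (J : ℝ → B)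
    (hJ : ∀ s t, a ≤ s → s ≤ t → t ≤ b → ‖J t - J s - μ s t‖ ≤ C * (t - s) ^ (1 + ε)) :
    RiemannLimit a b μ (J b - J a) := by
  intro η hη
  have hl : Filter.Tendsto (fun δ : ℝ => C * δ ^ ε * (b - a)) (nhds 0)
      (nhds (C * 0 ^ ε * (b - a))) :=
    ((Real.continuousAt_rpow_const 0 ε (Or.inr hε.le)).tendsto.const_mul C).mul_const _
  rw [Real.zero_rpow hε.ne', mul_zero, zero_mul] at hl
  obtain ⟨δ, hδ, hδ0⟩ : ∃ δ : ℝ, C * δ ^ ε * (b - a) < η ∧ 0 < δ :=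
    (((hl.mono_left nhdsWithin_le_nhds).eventually_lt_const hη).and
      (self_mem_nhdsWithin : Set.Ioi (0:ℝ) ∈ nhdsWithin 0 (Set.Ioi 0))).exists
  refine ⟨δ, hδ0, fun m t ⟨hmono, h0, hlast⟩ hmesh => ?_⟩
  have tel : ∀ {G : Type _} [AddCommGroup G] (f : Fin (m + 1) → G),
      ∑ i : Fin m, (f i.succ - f i.castSucc) = f (Fin.last m) - f 0 := by
    intro G _ f
    have h1 := Fin.sum_univ_succ f
    have h2 := Fin.sum_univ_castSucc f
    rw [Finset.sum_sub_distrib, sub_eq_sub_iff_add_eq_add, add_comm, ← h1, h2, add_comm]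
  have hJs : J b - J a = ∑ i : Fin m, (J (t i.succ) - J (t i.castSucc)) := by
    have h1 := Fin.sum_univ_succ (fun i => J (t i))
    have h2 := Fin.sum_univ_castSucc (fun i => J (t i))
    rw [Finset.sum_sub_distrib, eq_sub_iff_add_eq, ← h0, ← hlast, sub_add_eq_add_sub,
      sub_eq_iff_eq_add, add_comm (J _), ← h2, h1, add_comm]
  have hts : ∑ i : Fin m, (t i.succ - t i.castSucc) = b - a := by rw [tel t, h0, hlast]
  rw [hJs, ← Finset.sum_sub_distrib]
  refine lt_of_le_of_lt (norm_sum_le _ _) (lt_of_le_of_lt ?_ hδ)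
  rw [← hts, Finset.mul_sum]
  refine Finset.sum_le_sum fun i _ => ?_
  have hlt : t i.castSucc < t i.succ := hmono (Fin.castSucc_lt_succ)
  have hle : t i.succ - t i.castSucc ≤ δ :=
    (le_ciSup (f := fun i : Fin m => t i.succ - t i.castSucc) (Set.finite_range _).bddAbove i).trans
      hmesh.le
  have hbd := hJ (t i.castSucc) (t i.succ) (h0 ▸ hmono.monotone (Fin.zero_le _)) hlt.le
    (hlast ▸ hmono.monotone (Fin.le_last _))
  rw [norm_sub_rev]
  refine hbd.trans ?_
  rw [Real.rpow_add (by linarith), Real.rpow_one, mul_comm (t i.succ - t i.castSucc), ← mul_assoc]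
  have h5 : (t i.succ - t i.castSucc) ^ ε ≤ δ ^ ε := Real.rpow_le_rpow (by linarith) hle hε.le
  have h6 : 0 ≤ t i.succ - t i.castSucc := by linarith
  gcongr

/-- **Sewing lemma.** If `μ : [a,b]² → B` is continuous and satisfies
`‖μ(s,t) − μ(s,c) − μ(c,t)‖ ≤ K|t−s|^{1+ε}` for `a ≤ s ≤ c ≤ t ≤ b`, then there exists
a function `𝒥μ`, unique up to an additive constant, with
`‖𝒥μ(t) − 𝒥μ(s) − μ(s,t)‖ ≤ K(1 − 2^{−ε})⁻¹|t−s|^{1+ε}`, and the Riemann sums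
converge to `𝒥μ(b) − 𝒥μ(a)` as the mesh tends to `0`. -/
theorem sewing_lemma {B : Type*} [NormedAddCommGroup B] [NormedSpace ℝ B] [CompleteSpace B]
    (a b : ℝ) (hab : a < b) (ε : ℝ) (hε : 0 < ε) (K : ℝ) (hK : 0 ≤ K)
    (μ : ℝ → ℝ → B)
    (hcont : ContinuousOn (fun p : ℝ × ℝ => μ p.1 p.2) (Set.Icc a b ×ˢ Set.Icc a b))
    (hμ : ∀ s c t : ℝ, a ≤ s → s ≤ c → c ≤ t → t ≤ b →
      ‖μ s t - μ s c - μ c t‖ ≤ K * |t - s| ^ (1 + ε)) :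
    ∃ J : ℝ → B,
      (∀ s t : ℝ, a ≤ s → s ≤ t → t ≤ b →
        ‖J t - J s - μ s t‖ ≤ K * (1 - (2 : ℝ) ^ (-ε))⁻¹ * |t - s| ^ (1 + ε)) ∧
      (∀ J' : ℝ → B,
        (∀ s t : ℝ, a ≤ s → s ≤ t → t ≤ b →
          ‖J' t - J' s - μ s t‖ ≤ K * (1 - (2 : ℝ) ^ (-ε))⁻¹ * |t - s| ^ (1 + ε)) →
        ∃ c : B, ∀ t ∈ Set.Icc a b, J' t = J t + c) ∧
      RiemannLimit a b μ (J b - J a) := by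
  have hμ' : ∀ s c t : ℝ, a ≤ s → s ≤ c → c ≤ t → t ≤ b →
      ‖μ s t - μ s c - μ c t‖ ≤ K * (t - s) ^ (1 + ε) := by
    intro s c t h1 h2 h3 h4
    have := hμ s c t h1 h2 h3 h4
    rwa [abs_of_nonneg (by linarith)] at this
  obtain ⟨I, hmid, hbd, hIc⟩ := sew_exists a b ε hε K hK μ hcont hμ'
  have hr := sew_r_lt ε hε
  obtain ⟨C, hCdef⟩ : ∃ C, C = K * (1 - (2 : ℝ) ^ (-ε))⁻¹ := ⟨_, rfl⟩
  have hC : 0 ≤ C := by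
    rw [hCdef]; exact mul_nonneg hK (inv_nonneg.2 (by linarith))
  rw [← hCdef] at hbd ⊢
  have hadd := sew_additive a b ε hε (C + C + C + K) (by positivity) I hmid (by
    intro s c t h1 h2 h3 h4
    have e1 := hbd s t h1 (h2.trans h3) h4
    have e2 := hbd s c h1 h2 (h3.trans h4)
    have e3 := hbd c t (h1.trans h2) h3 h4
    have e4 := hμ' s c t h1 h2 h3 h4
    have f2 : (c - s) ^ (1 + ε) ≤ (t - s) ^ (1 + ε) :=
      Real.rpow_le_rpow (by linarith) (by linarith) (by linarith)
    have f3 : (t - c) ^ (1 + ε) ≤ (t - s) ^ (1 + ε) :=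
      Real.rpow_le_rpow (by linarith) (by linarith) (by linarith)
    have g2 := mul_le_mul_of_nonneg_left f2 hC
    have g3 := mul_le_mul_of_nonneg_left f3 hC
    have eq : I s t - I s c - I c t = (I s t - μ s t) - (I s c - μ s c) - (I c t - μ c t) +
      (μ s t - μ s c - μ c t) := by abel
    rw [eq]
    have n1 := norm_add_le ((I s t - μ s t) - (I s c - μ s c) - (I c t - μ c t))
      (μ s t - μ s c - μ c t)
    have n2 := norm_sub_le ((I s t - μ s t) - (I s c - μ s c)) (I c t - μ c t)
    have n3 := norm_sub_le (I s t - μ s t) (I s c - μ s c)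
    linarith) hIc
  have hJ : ∀ s t, a ≤ s → s ≤ t → t ≤ b →
      ‖I a t - I a s - μ s t‖ ≤ C * (t - s) ^ (1 + ε) := by
    intro s t h1 h2 h3
    rw [hadd a s t le_rfl h1 h2 h3, add_sub_cancel_left]
    exact hbd s t h1 h2 h3
  refine ⟨fun t => I a t, ?_, ?_, sew_riemann a b hab ε hε C hC μ (fun t => I a t) hJ⟩
  · intro s t h1 h2 h3
    rw [abs_of_nonneg (by linarith)]
    exact hJ s t h1 h2 h3
  · intro J' hJ'
    have hU := sew_unique a b ε hε (C + C) (fun s t => (J' t - J' s) - (I a t - I a s))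
      (by intro s t _ _ _; abel) (by
        intro s t h1 h2 h3
        have e1 := hJ' s t h1 h2 h3
        rw [abs_of_nonneg (by linarith)] at e1
        have e2 := hJ s t h1 h2 h3
        have n := norm_sub_le (J' t - J' s - μ s t) (I a t - I a s - μ s t)
        rw [sub_sub_sub_cancel_right] at n
        try simp only
        linarith)
    refine ⟨J' a - I a a, fun t ht => ?_⟩
    have := hU a t le_rfl ht.1 ht.2
    try simp only at this
    rw [sub_eq_zero, sub_eq_iff_eq_add] at this
    try simp only
    rw [this]; abel

end
end

section
/- Let (B, ‖·‖) be a Banach space, a < b and α > 1. Let μ₁, μ₂ : [a,b]² → B be continuous functions with [μ_i]_{α;[a,b]} := sup_{a≤s<c<t≤b} ‖μ_i(s,t) − μ_i(s,c) − μ_i(c,t)‖ / |t−s|^α finite for i = 1,2. Then for every a ≤ s ≤ t ≤ b, ‖𝒥_s^t μ₁ − 𝒥_s^t μ₂‖ ≤ ‖μ₁(s,t) − μ₂(s,t)‖ + (1 − 2^{1−α})^{−1} [μ₁ − μ₂]_{α;[s,t]} |t−s|^α. -/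
open scoped BigOperators

noncomputable section

/-- The set of quotients entering the seminorm
`[μ]_{α;[a,b]} = sup_{a ≤ s < c < t ≤ b} ‖μ(s,t) − μ(s,c) − μ(c,t)‖ / |t−s|^α`. -/
def germBracketSet {B : Type*} [NormedAddCommGroup B] (μ : ℝ → ℝ → B) (α a b : ℝ) : Set ℝ :=
  {r | ∃ s c t : ℝ, a ≤ s ∧ s < c ∧ c < t ∧ t ≤ b ∧
    r = ‖μ s t - μ s c - μ c t‖ / |t - s| ^ α}

/-- The seminorm `[μ]_{α;[a,b]}`. -/
def germBracket {B : Type*} [NormedAddCommGroup B] (μ : ℝ → ℝ → B) (α a b : ℝ) : ℝ :=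
  sSup (germBracketSet μ α a b)


theorem sum_range_two_mul_aux {B : Type*} [AddCommGroup B] (f : ℕ → B) (n : ℕ) :
    ∑ i ∈ Finset.range (2 * n), f i = ∑ i ∈ Finset.range n, (f (2 * i) + f (2 * i + 1)) := by
  induction n with
  | zero => simp
  | succ k ih =>
    rw [show 2 * (k + 1) = 2 * k + 1 + 1 by ring, Finset.sum_range_succ, Finset.sum_range_succ, ih,
      Finset.sum_range_succ]
    abel

/-- dyadic Riemann sum -/
def dyadSum {B : Type*} [NormedAddCommGroup B] (μ : ℝ → ℝ → B) (s t : ℝ) (n : ℕ) : B :=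
  ∑ i ∈ Finset.range (2 ^ n), μ (s + i * ((t - s) / 2 ^ n)) (s + (i + 1 : ℕ) * ((t - s) / 2 ^ n))

theorem dyadSum_zero {B : Type*} [NormedAddCommGroup B] (μ : ℝ → ℝ → B) (s t : ℝ) :
    dyadSum μ s t 0 = μ s t := by
  simp [dyadSum]

theorem dyadSum_tendsto {B : Type*} [NormedAddCommGroup B] (μ : ℝ → ℝ → B) (s t : ℝ) (hst : s < t)
    (I : B) (h : RiemannLimit s t μ I) :
    Filter.Tendsto (dyadSum μ s t) Filter.atTop (nhds I) := by
  rw [Metric.tendsto_atTop]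
  intro ε hε
  obtain ⟨δ, hδ, H⟩ := h ε hε
  have hlim : Filter.Tendsto (fun n : ℕ => (t - s) * (1 / 2 : ℝ) ^ n) Filter.atTop (nhds 0) := by
    simpa using (tendsto_pow_atTop_nhds_zero_of_lt_one (r := (1 / 2 : ℝ)) (by norm_num)
      (by norm_num)).const_mul (t - s)
  obtain ⟨N, hN⟩ := Filter.eventually_atTop.1 (hlim.eventually (gt_mem_nhds hδ))
  refine ⟨N, fun n hn => ?_⟩
  have h1 := hN n hn
  have hpos : 0 < (t - s) / 2 ^ n := div_pos (by linarith) (by positivity)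
  have h2 : (t - s) / 2 ^ n < δ := by
    rw [one_div, inv_pow] at h1
    exact h1
  have h3 := H (2 ^ n) (fun i => s + ((i : ℕ) : ℝ) * ((t - s) / 2 ^ n)) ⟨?_, ?_, ?_⟩ ?_
  · rw [dist_eq_norm, dyadSum, Finset.sum_range]
    simpa using h3
  · intro i j hij
    have : ((i : ℕ) : ℝ) < ((j : ℕ) : ℝ) := by exact_mod_cast hij
    have := mul_lt_mul_of_pos_right this hpos
    simp only
    linarith
  · simp
  · simp only [Fin.val_last]
    push_cast
    field_simp
    ring
  · have hne : Nonempty (Fin (2 ^ n)) := ⟨⟨0, by positivity⟩⟩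
    refine lt_of_le_of_lt (ciSup_le (c := (t - s) / 2 ^ n) fun i => ?_) h2
    simp only [Fin.val_succ, Fin.val_castSucc]
    push_cast
    apply le_of_eq
    ring

theorem dyadSum_step {B : Type*} [NormedAddCommGroup B] (μ : ℝ → ℝ → B) (s t α K : ℝ) (hst : s < t)
    (hK : ∀ u c v, s ≤ u → u < c → c < v → v ≤ t → ‖μ u v - μ u c - μ c v‖ ≤ K * (v - u) ^ α)
    (n : ℕ) :
    ‖dyadSum μ s t n - dyadSum μ s t (n + 1)‖ ≤ K * (t - s) ^ α * ((2 : ℝ) ^ (1 - α)) ^ n := by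
  have hpos : 0 < (t - s) / 2 ^ n := div_pos (by linarith) (by positivity)
  have hval : ((2 : ℝ) ^ n) * (K * ((t - s) / 2 ^ n) ^ α)
      = K * (t - s) ^ α * ((2 : ℝ) ^ (1 - α)) ^ n := by
    rw [Real.div_rpow (by linarith) (by positivity), Real.rpow_sub (by norm_num), Real.rpow_one,
      div_pow, ← Real.rpow_natCast (2 ^ α) n, ← Real.rpow_mul (by norm_num), mul_comm α,
      Real.rpow_mul (by norm_num), Real.rpow_natCast]
    ring
  rw [dyadSum, dyadSum, pow_succ' 2 n, sum_range_two_mul_aux, ← Finset.sum_sub_distrib, ← hval]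
  refine (norm_sum_le _ _).trans ?_
  refine (Finset.sum_le_sum (g := fun _ => K * ((t - s) / 2 ^ n) ^ α) ?_).trans (by simp)
  intro i hi
  set h := (t - s) / 2 ^ n with hh
  have e : (t - s) / 2 ^ (n + 1) = h / 2 := by rw [hh, pow_succ]; field_simp
  have hi' : ((i : ℝ) + 1) ≤ 2 ^ n := by exact_mod_cast Finset.mem_range.1 hi
  have hT : 2 ^ n * h = t - s := by rw [hh]; field_simp
  have hm := mul_le_mul_of_nonneg_right hi' hpos.le
  have hi0 : 0 ≤ (i : ℝ) * h := by positivity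
  have key := hK (s + i * h) (s + i * h + h / 2) (s + i * h + h) (by linarith) (by linarith)
    (by linarith) (by linarith)
  rw [e]
  have e1 : s + ((i + 1 : ℕ) : ℝ) * h = s + i * h + h := by push_cast; ring
  have e2 : s + ((2 * i : ℕ) : ℝ) * (h / 2) = s + i * h := by push_cast; ring
  have e3 : s + ((2 * i + 1 : ℕ) : ℝ) * (h / 2) = s + i * h + h / 2 := by push_cast; ring
  have e4 : s + ((2 * i + 1 + 1 : ℕ) : ℝ) * (h / 2) = s + i * h + h := by push_cast; ring
  rw [e1, e2, e3, e4, ← sub_sub]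
  rwa [show s + i * h + h - (s + i * h) = h by ring] at key

theorem dyadSum_bound {B : Type*} [NormedAddCommGroup B] (μ : ℝ → ℝ → B) (s t α K : ℝ) (hst : s < t)
    (hα : 1 < α) (hK0 : 0 ≤ K)
    (hK : ∀ u c v, s ≤ u → u < c → c < v → v ≤ t → ‖μ u v - μ u c - μ c v‖ ≤ K * (v - u) ^ α)
    (n : ℕ) :
    ‖dyadSum μ s t n‖ ≤ ‖μ s t‖ + (1 - (2 : ℝ) ^ (1 - α))⁻¹ * K * (t - s) ^ α := by
  have hr0 : (0 : ℝ) ≤ (2 : ℝ) ^ (1 - α) := by positivity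
  have hr1 : (2 : ℝ) ^ (1 - α) < 1 := Real.rpow_lt_one_of_one_lt_of_neg (by norm_num) (by linarith)
  have hts : 0 ≤ (t - s) ^ α := Real.rpow_nonneg (by linarith) _
  have h1 : ‖dyadSum μ s t n‖ ≤ ‖μ s t‖ +
      ∑ i ∈ Finset.range n, K * (t - s) ^ α * ((2 : ℝ) ^ (1 - α)) ^ i := by
    induction n with
    | zero => simp [dyadSum_zero]
    | succ k ih =>
      rw [Finset.sum_range_succ]
      have := dyadSum_step μ s t α K hst hK k
      have h2 := norm_sub_norm_le (dyadSum μ s t (k + 1)) (dyadSum μ s t k)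
      rw [norm_sub_rev] at h2
      linarith
  refine h1.trans ?_
  rw [← Finset.mul_sum]
  have h2 : ∑ i ∈ Finset.range n, ((2 : ℝ) ^ (1 - α)) ^ i ≤ (1 - (2 : ℝ) ^ (1 - α))⁻¹ := by
    rw [← tsum_geometric_of_lt_one hr0 hr1]
    exact (summable_geometric_of_lt_one hr0 hr1).sum_le_tsum _ (fun i _ => by positivity)
  have := mul_le_mul_of_nonneg_left h2 (mul_nonneg hK0 hts)
  linarith

theorem germ_bound {B : Type*} [NormedAddCommGroup B] (μ : ℝ → ℝ → B) (s t α K : ℝ)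
    (hK : K ∈ upperBounds (germBracketSet μ α s t)) :
    ∀ u c v, s ≤ u → u < c → c < v → v ≤ t → ‖μ u v - μ u c - μ c v‖ ≤ K * (v - u) ^ α := by
  intro u c v h1 h2 h3 h4
  have := hK ⟨u, c, v, h1, h2, h3, h4, rfl⟩
  have hp : 0 < v - u := by linarith
  rw [abs_of_pos hp] at this
  exact (div_le_iff₀ (Real.rpow_pos_of_pos hp α)).1 this

theorem riemann_self {B : Type*} [NormedAddCommGroup B] (μ : ℝ → ℝ → B) (s : ℝ) (I : B)
    (h : RiemannLimit s s μ I) : I = 0 := by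
  by_contra hI
  obtain ⟨δ, hδ, H⟩ := h ‖I‖ (norm_pos_iff.2 hI)
  have := H 0 (fun _ => s) ⟨fun i j hij => by omega, rfl, rfl⟩
    (by simpa [partMesh] using hδ)
  simp at this

/-- Quantitative comparison of sewing integrals:
`‖𝒥_s^t μ₁ − 𝒥_s^t μ₂‖ ≤ ‖μ₁(s,t) − μ₂(s,t)‖ + (1 − 2^{1−α})⁻¹ [μ₁ − μ₂]_{α;[s,t]} |t−s|^α`. -/
theorem sewing_quantitative_comparison {B : Type*}
    [NormedAddCommGroup B] [NormedSpace ℝ B] [CompleteSpace B]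
    (a b : ℝ) (hab : a < b) (α : ℝ) (hα : 1 < α)
    (μ₁ μ₂ : ℝ → ℝ → B)
    (hcont₁ : ContinuousOn (fun p : ℝ × ℝ => μ₁ p.1 p.2) (Set.Icc a b ×ˢ Set.Icc a b))
    (hcont₂ : ContinuousOn (fun p : ℝ × ℝ => μ₂ p.1 p.2) (Set.Icc a b ×ˢ Set.Icc a b))
    (hμ₁ : BddAbove (germBracketSet μ₁ α a b))
    (hμ₂ : BddAbove (germBracketSet μ₂ α a b)) :
    ∀ s t : ℝ, a ≤ s → s ≤ t → t ≤ b →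
      ∀ I₁ I₂ : B, RiemannLimit s t μ₁ I₁ → RiemannLimit s t μ₂ I₂ →
        ‖I₁ - I₂‖ ≤ ‖μ₁ s t - μ₂ s t‖ +
          (1 - (2 : ℝ) ^ (1 - α))⁻¹ *
            germBracket (fun u v => μ₁ u v - μ₂ u v) α s t * |t - s| ^ α := by
  intro s t has hst htb I₁ I₂ h₁ h₂
  rcases hst.eq_or_lt with rfl | hlt
  · rw [riemann_self _ _ _ h₁, riemann_self _ _ _ h₂]
    simp [Real.zero_rpow (by linarith : α ≠ 0)]
  set ν : ℝ → ℝ → B := fun u v => μ₁ u v - μ₂ u v with hν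
  obtain ⟨C₁, hC₁⟩ := hμ₁
  obtain ⟨C₂, hC₂⟩ := hμ₂
  have hbdd : BddAbove (germBracketSet ν α s t) := by
    refine ⟨C₁ + C₂, ?_⟩
    rintro r ⟨u, c, v, h1, h2, h3, h4, rfl⟩
    have k1 := hC₁ ⟨u, c, v, has.trans h1, h2, h3, h4.trans htb, rfl⟩
    have k2 := hC₂ ⟨u, c, v, has.trans h1, h2, h3, h4.trans htb, rfl⟩
    refine le_trans ?_ (add_le_add k1 k2)
    rw [← add_div]
    have hn : (0 : ℝ) ≤ |v - u| ^ α := by positivity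
    refine div_le_div_of_nonneg_right ?_ hn
    refine le_trans (le_of_eq ?_) (norm_sub_le _ _)
    congr 1
    simp only [hν]
    abel
  have hK : germBracket ν α s t ∈ upperBounds (germBracketSet ν α s t) :=
    fun r hr => le_csSup hbdd hr
  have hK0 : 0 ≤ germBracket ν α s t := by
    apply Real.sSup_nonneg
    rintro r ⟨u, c, v, h1, h2, h3, h4, rfl⟩
    positivity
  have hb := dyadSum_bound ν s t α _ hlt hα hK0 (germ_bound ν s t α _ hK)
  have hlim := (dyadSum_tendsto μ₁ s t hlt I₁ h₁).sub (dyadSum_tendsto μ₂ s t hlt I₂ h₂)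
  rw [abs_of_pos (sub_pos.2 hlt)]
  refine le_of_tendsto hlim.norm (Filter.Eventually.of_forall fun n => ?_)
  refine le_trans (le_of_eq ?_) (hb n)
  simp only [dyadSum, hν, Finset.sum_sub_distrib]

end
end

section
/- Let a < b, let W : ℝ × ℝ^d → ℝ^d satisfy condition (W) with exponents τ, λ ∈ (0,1], β ≥ 0, let φ : ℝ → ℝ^d be γ-Hölder continuous on [a,b] with τ + λγ > 1. Then the indefinite nonlinear Young integral t ↦ ∫_a^t W(ds, φ_s), t ∈ [a,b], is Hölder continuous of exponent τ on [a,b]. -/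
open scoped BigOperators

noncomputable section

/-- The germ of the nonlinear Young integral `∫ W(ds, φ_s)`:
`(s,t) ↦ W(t, φ_s) − W(s, φ_s)`. -/
def youngGerm {d : ℕ} (W : ℝ → EuclideanSpace ℝ (Fin d) → EuclideanSpace ℝ (Fin d))
    (φ : ℝ → EuclideanSpace ℝ (Fin d)) : ℝ → ℝ → EuclideanSpace ℝ (Fin d) :=
  fun s t => W t (φ s) - W s (φ s)

/-- `I` is the value of the nonlinear Young integral `∫_a^b W(ds, φ_s)`, i.e. the limit of
the Riemann sums `Σ_i (W(t_{i+1}, φ_{t_i}) − W(t_i, φ_{t_i}))` as the mesh tends to `0`. -/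
def HasYoungIntegral {d : ℕ} (W : ℝ → EuclideanSpace ℝ (Fin d) → EuclideanSpace ℝ (Fin d))
    (φ : ℝ → EuclideanSpace ℝ (Fin d)) (a b : ℝ) (I : EuclideanSpace ℝ (Fin d)) : Prop :=
  RiemannLimit a b (youngGerm W φ) I

/-- The set of quotients entering the Hölder seminorm `‖φ‖_{γ;a,b}`. -/
def holderSet {F : Type*} [NormedAddCommGroup F] (φ : ℝ → F) (γ a b : ℝ) : Set ℝ :=
  {r | ∃ s t : ℝ, a ≤ s ∧ s < t ∧ t ≤ b ∧ r = ‖φ t - φ s‖ / (t - s) ^ γ}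

/-- The Hölder seminorm `‖φ‖_{γ;a,b} = sup_{a ≤ s < t ≤ b} ‖φ_t − φ_s‖/(t−s)^γ`. -/
def holderSemi {F : Type*} [NormedAddCommGroup F] (φ : ℝ → F) (γ a b : ℝ) : ℝ :=
  sSup (holderSet φ γ a b)

/-- `φ` is `γ`-Hölder continuous on `[a,b]`. -/
def HolderOn {F : Type*} [NormedAddCommGroup F] (φ : ℝ → F) (γ a b : ℝ) : Prop :=
  BddAbove (holderSet φ γ a b)

/-- The sup norm `‖φ‖_{∞;a,b} = sup_{a ≤ t ≤ b} ‖φ_t‖`. -/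
def supNorm {F : Type*} [NormedAddCommGroup F] (φ : ℝ → F) (a b : ℝ) : ℝ :=
  sSup ((fun u => ‖φ u‖) '' Set.Icc a b)

/-- Quotients of the first term of the seminorm `‖W‖_{β,τ,λ;a,b}` ( = `[W]_{β,τ,λ;a,b}`). -/
def wSet1 {d : ℕ} (W : ℝ → EuclideanSpace ℝ (Fin d) → EuclideanSpace ℝ (Fin d))
    (β τ lam a b : ℝ) : Set ℝ :=
  {r | ∃ (s t : ℝ) (x y : EuclideanSpace ℝ (Fin d)), a ≤ s ∧ s < t ∧ t ≤ b ∧ x ≠ y ∧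
    r = ‖W s x - W t x - W s y + W t y‖ /
      ((1 + ‖x‖ + ‖y‖) ^ β * (t - s) ^ τ * ‖x - y‖ ^ lam)}

/-- Quotients of the second term of the seminorm `‖W‖_{β,τ,λ;a,b}`. -/
def wSet2 {d : ℕ} (W : ℝ → EuclideanSpace ℝ (Fin d) → EuclideanSpace ℝ (Fin d))
    (β τ lam a b : ℝ) : Set ℝ :=
  {r | ∃ (s t : ℝ) (x : EuclideanSpace ℝ (Fin d)), a ≤ s ∧ s < t ∧ t ≤ b ∧
    r = ‖W s x - W t x‖ / ((1 + ‖x‖) ^ (β + lam) * (t - s) ^ τ)}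

/-- Quotients of the third term of the seminorm `‖W‖_{β,τ,λ;a,b}`. -/
def wSet3 {d : ℕ} (W : ℝ → EuclideanSpace ℝ (Fin d) → EuclideanSpace ℝ (Fin d))
    (β τ lam a b : ℝ) : Set ℝ :=
  {r | ∃ (t : ℝ) (x y : EuclideanSpace ℝ (Fin d)), a ≤ t ∧ t ≤ b ∧ x ≠ y ∧
    r = ‖W t x - W t y‖ / ((1 + ‖x‖ + ‖y‖) ^ β * ‖x - y‖ ^ lam)}

/-- Condition (W) on `[a,b]`: the seminorm `‖W‖_{β,τ,λ;a,b}` is finite. -/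
def ConditionW {d : ℕ} (W : ℝ → EuclideanSpace ℝ (Fin d) → EuclideanSpace ℝ (Fin d))
    (β τ lam a b : ℝ) : Prop :=
  BddAbove (wSet1 W β τ lam a b) ∧ BddAbove (wSet2 W β τ lam a b) ∧
    BddAbove (wSet3 W β τ lam a b)

/-- The seminorm `‖W‖_{β,τ,λ;a,b}` (sum of the three suprema). -/
def wNorm {d : ℕ} (W : ℝ → EuclideanSpace ℝ (Fin d) → EuclideanSpace ℝ (Fin d))
    (β τ lam a b : ℝ) : ℝ :=
  sSup (wSet1 W β τ lam a b) + sSup (wSet2 W β τ lam a b) + sSup (wSet3 W β τ lam a b)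

/-- The first supremum `[W]_{β,τ,λ;a,b}` alone. -/
def wBracket {d : ℕ} (W : ℝ → EuclideanSpace ℝ (Fin d) → EuclideanSpace ℝ (Fin d))
    (β τ lam a b : ℝ) : ℝ :=
  sSup (wSet1 W β τ lam a b)


/-- The Riemann sum over the uniform dyadic partition of `[s,t]`. -/
def dySum {d : ℕ} (μ : ℝ → ℝ → EuclideanSpace ℝ (Fin d)) (n : ℕ) (s t : ℝ) :
    EuclideanSpace ℝ (Fin d) :=
  ∑ i ∈ Finset.range (2 ^ n), μ (s + i * ((t - s) / 2 ^ n)) (s + (i + 1 : ℕ) * ((t - s) / 2 ^ n))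

theorem dySum_succ {d : ℕ} (μ : ℝ → ℝ → EuclideanSpace ℝ (Fin d)) (n : ℕ) (s t : ℝ) :
    dySum μ (n + 1) s t = dySum μ n s ((s + t) / 2) + dySum μ n ((s + t) / 2) t := by
  unfold dySum
  rw [show 2 ^ (n + 1) = 2 ^ n + 2 ^ n by ring, Finset.sum_range_add]
  have h2 : (2 : ℝ) ^ n ≠ 0 := by positivity
  congr 1
  · refine Finset.sum_congr rfl fun i _ => ?_
    congr 1 <;> (push_cast; field_simp; ring)
  · refine Finset.sum_congr rfl fun i _ => ?_
    congr 1 <;> (push_cast; field_simp; ring)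

theorem dySum_bound {d : ℕ} (μ : ℝ → ℝ → EuclideanSpace ℝ (Fin d)) (a b θ K : ℝ)
    (hθ : 1 < θ)
    (h : ∀ s u t, a ≤ s → s < u → u < t → t ≤ b →
      ‖μ s u + μ u t - μ s t‖ ≤ K * (t - s) ^ θ) (n : ℕ) :
    ∀ s t, a ≤ s → s < t → t ≤ b →
      ‖dySum μ n s t - μ s t‖ ≤ |K| / (1 - 2 ^ (1 - θ)) * (t - s) ^ θ := by
  have hq : (2 : ℝ) ^ (1 - θ) < 1 := Real.rpow_lt_one_of_one_lt_of_neg (by norm_num) (by linarith)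
  have hq' : 0 < 1 - (2 : ℝ) ^ (1 - θ) := by linarith
  set M := |K| / (1 - 2 ^ (1 - θ)) with hM
  have hMK : M * (1 - 2 ^ (1 - θ)) = |K| := by rw [hM]; field_simp
  have hM0 : 0 ≤ M := by rw [hM]; positivity
  induction n with
  | zero =>
    intro s t _ hst _
    have : dySum μ 0 s t = μ s t := by simp [dySum]
    rw [this, sub_self, norm_zero]
    have : 0 ≤ (t - s) ^ θ := Real.rpow_nonneg (by linarith) _
    positivity
  | succ n ih =>
    intro s t has hst htb
    rw [dySum_succ]
    set m := (s + t) / 2 with hm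
    have h1 := ih s m has (by linarith) (by linarith)
    have h2 := ih m t (by linarith) (by linarith) (by linarith)
    have h3 := h s m t has (by linarith) (by linarith) htb
    have e1 : m - s = (t - s) / 2 := by rw [hm]; ring
    have e2 : t - m = (t - s) / 2 := by rw [hm]; ring
    have e3 : ((t - s) / 2) ^ θ = (2 : ℝ) ^ (1 - θ) / 2 * (t - s) ^ θ := by
      rw [Real.div_rpow (by linarith) (by norm_num), Real.rpow_sub (by norm_num), Real.rpow_one]
      field_simp
    rw [e1, e3] at h1
    rw [e2, e3] at h2
    have h4 : 0 ≤ (t - s) ^ θ := Real.rpow_nonneg (by linarith) _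
    have h5 : K * (t - s) ^ θ ≤ |K| * (t - s) ^ θ := by gcongr; exact le_abs_self K
    calc ‖dySum μ n s m + dySum μ n m t - μ s t‖
        = ‖(dySum μ n s m - μ s m) + (dySum μ n m t - μ m t) + (μ s m + μ m t - μ s t)‖ := by
          congr 1; abel
      _ ≤ ‖dySum μ n s m - μ s m‖ + ‖dySum μ n m t - μ m t‖ + ‖μ s m + μ m t - μ s t‖ :=
          norm_add₃_le
      _ ≤ M * (2 ^ (1 - θ) / 2 * (t - s) ^ θ) + M * (2 ^ (1 - θ) / 2 * (t - s) ^ θ)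
          + M * (1 - 2 ^ (1 - θ)) * (t - s) ^ θ := by rw [hMK]; linarith
      _ = M * (t - s) ^ θ := by ring

/-- Apply a Riemann limit to a partition given by a sequence. -/
theorem RiemannLimit.seq {d : ℕ} {a t : ℝ} {μ : ℝ → ℝ → EuclideanSpace ℝ (Fin d)}
    {I : EuclideanSpace ℝ (Fin d)} (h : RiemannLimit a t μ I) {ε : ℝ} (hε : 0 < ε) :
    ∃ δ : ℝ, 0 < δ ∧ ∀ (m : ℕ) (u : ℕ → ℝ), u 0 = a → u m = t →
      (∀ i < m, u i < u (i + 1) ∧ u (i + 1) - u i ≤ δ) →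
      ‖(∑ i ∈ Finset.range m, μ (u i) (u (i + 1))) - I‖ < ε := by
  obtain ⟨δ, hδ, H⟩ := h ε hε
  refine ⟨δ / 2, by positivity, fun m u h0 hm hu => ?_⟩
  have := H m (fun i => u i) ⟨?_, by simpa using h0, by simpa using hm⟩ ?_
  · rw [Finset.sum_range]
    simpa using this
  · refine Fin.strictMono_iff_lt_succ.2 fun i => ?_
    simpa using (hu i i.2).1
  · unfold partMesh
    refine lt_of_le_of_lt (Real.iSup_le (a := δ / 2) (fun i => ?_) (by positivity)) (by linarith)
    simpa using (hu i i.2).2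

theorem exists_step (a s δ : ℝ) (hδ : 0 < δ) (h : a ≤ s) :
    ∃ (N : ℕ) (k : ℝ), 0 < k ∧ k ≤ δ ∧ a + N * k = s := by
  rcases h.eq_or_lt with rfl | h
  · exact ⟨0, δ, hδ, le_rfl, by simp⟩
  · obtain ⟨N, hN⟩ := exists_nat_gt ((s - a) / δ)
    have h0 : 0 < (s - a) / δ := div_pos (by linarith) hδ
    have hN0 : (0 : ℝ) < N := h0.trans hN
    refine ⟨N, (s - a) / N, div_pos (by linarith) hN0, ?_, by field_simp; ring⟩
    rw [div_le_iff₀ hN0]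
    rw [div_lt_iff₀ hδ] at hN
    linarith

theorem dySum_limit {d : ℕ} {a s t : ℝ} {μ : ℝ → ℝ → EuclideanSpace ℝ (Fin d)}
    {I J : EuclideanSpace ℝ (Fin d)} (has : a ≤ s) (hst : s < t)
    (hI : RiemannLimit a s μ I) (hJ : RiemannLimit a t μ J) {ε : ℝ} (hε : 0 < ε) :
    ∃ n, ‖dySum μ n s t - (J - I)‖ < ε := by
  obtain ⟨δ₁, hδ₁, H₁⟩ := hI.seq (half_pos hε)
  obtain ⟨δ₂, hδ₂, H₂⟩ := hJ.seq (half_pos hε)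
  obtain ⟨N, k, hk, hkδ, hN⟩ := exists_step a s (min δ₁ δ₂) (lt_min hδ₁ hδ₂) has
  obtain ⟨n, hn⟩ := pow_unbounded_of_one_lt ((t - s) / δ₂) (by norm_num : (1 : ℝ) < 2)
  have hp : (0 : ℝ) < 2 ^ n := by positivity
  set l := (t - s) / 2 ^ n with hl
  have hl0 : 0 < l := div_pos (by linarith) hp
  have hlδ : l ≤ δ₂ := by
    rw [hl, div_le_iff₀ hp]
    rw [div_lt_iff₀ hδ₂] at hn
    linarith
  have hlt : s + (2 ^ n : ℝ) * l = t := by rw [hl]; field_simp; ring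
  have A := H₁ N (fun i => a + i * k) (by simp) hN (fun i _ => by
    push_cast
    constructor
    · nlinarith
    · have := hkδ.trans (min_le_left _ _)
      linarith)
  set u : ℕ → ℝ := fun i => if i < N then a + i * k else s + ((i : ℝ) - N) * l with hu
  have u1 : ∀ i ≤ N, u i = a + i * k := by
    intro i hi
    rcases hi.lt_or_eq with hi | rfl
    · simp [hu, hi]
    · simp [hu, hN]
  have u2 : ∀ i, u (N + i) = s + i * l := by
    intro i
    simp [hu]
  have B := H₂ (N + 2 ^ n) u (by rw [u1 0 (Nat.zero_le _)]; simp)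
    (by rw [u2]; push_cast; exact hlt) (fun i _ => by
      rcases lt_or_ge i N with hi | hi
      · rw [u1 i hi.le, u1 (i + 1) hi]
        push_cast
        constructor
        · nlinarith
        · have := hkδ.trans (min_le_right _ _)
          linarith
      · obtain ⟨j, rfl⟩ := Nat.exists_eq_add_of_le hi
        rw [add_assoc, u2, u2]
        push_cast
        constructor
        · nlinarith
        · linarith)
  rw [Finset.sum_range_add] at B
  have E1 : ∑ i ∈ Finset.range N, μ (u i) (u (i + 1))
      = ∑ i ∈ Finset.range N, μ (a + i * k) (a + (i + 1 : ℕ) * k) := by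
    refine Finset.sum_congr rfl fun i hi => ?_
    have := Finset.mem_range.1 hi
    rw [u1 i this.le, u1 (i + 1) this]
  have E2 : ∑ i ∈ Finset.range (2 ^ n), μ (u (N + i)) (u (N + i + 1)) = dySum μ n s t := by
    refine Finset.sum_congr rfl fun i hi => ?_
    rw [add_assoc, u2, u2]
  rw [E1, E2] at B
  refine ⟨n, ?_⟩
  set S := ∑ i ∈ Finset.range N, μ (a + i * k) (a + (i + 1 : ℕ) * k)
  calc ‖dySum μ n s t - (J - I)‖ = ‖(S + dySum μ n s t - J) - (S - I)‖ := by congr 1; abel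
    _ ≤ ‖S + dySum μ n s t - J‖ + ‖S - I‖ := norm_sub_le _ _
    _ < ε := by linarith

theorem germ_bounds {d : ℕ} (W : ℝ → EuclideanSpace ℝ (Fin d) → EuclideanSpace ℝ (Fin d))
    (φ : ℝ → EuclideanSpace ℝ (Fin d)) (a b β τ lam γ : ℝ)
    (hβ : 0 ≤ β) (hτ : 0 < τ) (hlam : 0 < lam) (hγ : 0 < γ)
    (hW : ConditionW W β τ lam a b) (hφ : HolderOn φ γ a b) :
    ∃ A K : ℝ, 0 ≤ A ∧
      (∀ s t, a ≤ s → s < t → t ≤ b → ‖youngGerm W φ s t‖ ≤ A * (t - s) ^ τ) ∧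
      (∀ s u t, a ≤ s → s < u → u < t → t ≤ b →
        ‖youngGerm W φ s u + youngGerm W φ u t - youngGerm W φ s t‖
          ≤ K * (t - s) ^ (τ + lam * γ)) := by
  obtain ⟨⟨C₁, h₁⟩, ⟨C₂, h₂⟩, -⟩ := hW
  obtain ⟨H, hH⟩ := hφ
  have hφ' : ∀ s t, a ≤ s → s < t → t ≤ b → ‖φ t - φ s‖ ≤ |H| * (t - s) ^ γ := by
    intro s t h1 h2 h3
    have := hH ⟨s, t, h1, h2, h3, rfl⟩
    have hp : 0 < (t - s) ^ γ := Real.rpow_pos_of_pos (by linarith) _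
    rw [div_le_iff₀ hp] at this
    exact this.trans (by gcongr; exact le_abs_self H)
  obtain ⟨R, hR0, hR⟩ : ∃ R : ℝ, 0 ≤ R ∧ ∀ s, a ≤ s → s ≤ b → ‖φ s‖ ≤ R := by
    refine ⟨‖φ a‖ + |H| * |b - a| ^ γ, by positivity, fun s h1 h2 => ?_⟩
    rcases h1.eq_or_lt with rfl | h1
    · have : 0 ≤ |H| * |b - a| ^ γ := by positivity
      linarith
    · have h3 := hφ' a s le_rfl h1 h2
      have h4 : (s - a) ^ γ ≤ |b - a| ^ γ := by
        apply Real.rpow_le_rpow (by linarith) _ hγ.le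
        exact le_trans (by linarith) (le_abs_self _)
      calc ‖φ s‖ = ‖φ a + (φ s - φ a)‖ := by congr 1; abel
        _ ≤ ‖φ a‖ + ‖φ s - φ a‖ := norm_add_le _ _
        _ ≤ ‖φ a‖ + |H| * (s - a) ^ γ := by linarith
        _ ≤ _ := by gcongr
  refine ⟨|C₂| * (1 + R) ^ (β + lam), |C₁| * (1 + R + R) ^ β * |H| ^ lam, by positivity, ?_, ?_⟩
  · intro s t h1 h2 h3
    have := h₂ ⟨s, t, φ s, h1, h2, h3, rfl⟩
    have hp : 0 < (t - s) ^ τ := Real.rpow_pos_of_pos (by linarith) _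
    rw [div_le_iff₀ (by positivity)] at this
    have hs := hR s h1 (by linarith)
    unfold youngGerm
    rw [norm_sub_rev]
    calc _ ≤ _ := this
      _ ≤ |C₂| * ((1 + R) ^ (β + lam) * (t - s) ^ τ) := by gcongr; exact le_abs_self _
      _ = _ := by ring
  · intro s u t h1 h2 h3 h4
    have hts : 0 < t - s := by linarith
    have hs := hR s h1 (by linarith)
    have hu := hR u (by linarith) (by linarith)
    unfold youngGerm
    have e : W u (φ s) - W s (φ s) + (W t (φ u) - W u (φ u)) - (W t (φ s) - W s (φ s))
        = W u (φ s) - W t (φ s) - W u (φ u) + W t (φ u) := by abel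
    rw [e]
    by_cases hx : φ s = φ u
    · rw [hx]
      have : W u (φ u) - W t (φ u) - W u (φ u) + W t (φ u) = 0 := by abel
      rw [this, norm_zero]
      positivity
    · have := h₁ ⟨u, t, φ s, φ u, by linarith, h3, h4, hx, rfl⟩
      have hp : 0 < (t - u) ^ τ := Real.rpow_pos_of_pos (by linarith) _
      have hn : 0 < ‖φ s - φ u‖ := norm_pos_iff.2 (sub_ne_zero.2 hx)
      rw [div_le_iff₀ (by positivity)] at this
      have h5 : ‖φ s - φ u‖ ≤ |H| * (t - s) ^ γ := by
        rw [norm_sub_rev]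
        refine (hφ' s u h1 h2 (by linarith)).trans ?_
        gcongr
      have h6 : ‖φ s - φ u‖ ^ lam ≤ |H| ^ lam * (t - s) ^ (lam * γ) := by
        refine (Real.rpow_le_rpow hn.le h5 hlam.le).trans ?_
        rw [Real.mul_rpow (abs_nonneg _) (by positivity), ← Real.rpow_mul hts.le, mul_comm γ]
      have h7 : (t - u) ^ τ ≤ (t - s) ^ τ :=
        Real.rpow_le_rpow (by linarith) (by linarith) hτ.le
      calc _ ≤ _ := this
        _ ≤ |C₁| * ((1 + R + R) ^ β * (t - s) ^ τ * (|H| ^ lam * (t - s) ^ (lam * γ))) := by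
          gcongr; exact le_abs_self _
        _ = _ := by rw [Real.rpow_add hts]; ring

/-- **Hölder continuity of the indefinite nonlinear Young integral** (Proposition 2.7):
under condition (W) and `γ`-Hölder continuity of `φ` with `τ + λγ > 1`, the function
`t ↦ ∫_a^t W(ds, φ_s)` is Hölder continuous of exponent `τ` on `[a,b]`. -/
theorem indefinite_young_integral_holder
    (d : ℕ) (W : ℝ → EuclideanSpace ℝ (Fin d) → EuclideanSpace ℝ (Fin d))
    (φ : ℝ → EuclideanSpace ℝ (Fin d)) (a b β τ lam γ : ℝ)
    (hab : a < b) (hβ : 0 ≤ β)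
    (hτ : τ ∈ Set.Ioc (0 : ℝ) 1) (hlam : lam ∈ Set.Ioc (0 : ℝ) 1) (hγ : γ ∈ Set.Ioc (0 : ℝ) 1)
    (hsum : 1 < τ + lam * γ)
    (hW : ConditionW W β τ lam a b) (hφ : HolderOn φ γ a b)
    (F : ℝ → EuclideanSpace ℝ (Fin d))
    (hF : ∀ t ∈ Set.Icc a b, HasYoungIntegral W φ a t (F t)) :
    ∃ C : ℝ, 0 ≤ C ∧ ∀ s ∈ Set.Icc a b, ∀ t ∈ Set.Icc a b,
      ‖F t - F s‖ ≤ C * |t - s| ^ τ := by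
  have hτ0 := hτ.1
  obtain ⟨A, K, hA, hg1, hg2⟩ :=
    germ_bounds W φ a b β τ lam γ hβ hτ.1 hlam.1 hγ.1 hW hφ
  set θ := τ + lam * γ with hθ
  have hlg : 0 < lam * γ := mul_pos hlam.1 hγ.1
  have hq : (2 : ℝ) ^ (1 - θ) < 1 := Real.rpow_lt_one_of_one_lt_of_neg (by norm_num) (by linarith)
  have hq' : 0 < 1 - (2 : ℝ) ^ (1 - θ) := by linarith
  have hba : 0 < b - a := by linarith
  have key := dySum_bound (youngGerm W φ) a b θ K hsum hg2
  set M := |K| / (1 - 2 ^ (1 - θ)) with hM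
  have hM0 : 0 ≤ M := by rw [hM]; positivity
  have main : ∀ s t, a ≤ s → s < t → t ≤ b →
      ‖F t - F s‖ ≤ (A + M * (b - a) ^ (lam * γ)) * (t - s) ^ τ := by
    intro s t h1 h2 h3
    have hts : 0 < t - s := by linarith
    refine le_of_forall_pos_lt_add fun ε hε => ?_
    obtain ⟨n, hn⟩ := dySum_limit h1 h2 (hF s ⟨h1, by linarith⟩) (hF t ⟨by linarith, h3⟩) hε
    have k1 := key n s t h1 h2 h3
    have k2 := hg1 s t h1 h2 h3
    have k3 : (t - s) ^ θ ≤ (b - a) ^ (lam * γ) * (t - s) ^ τ := by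
      rw [hθ, Real.rpow_add hts, mul_comm]
      gcongr
    have k4 : M * (t - s) ^ θ ≤ M * ((b - a) ^ (lam * γ) * (t - s) ^ τ) := by gcongr
    set D := dySum (youngGerm W φ) n s t
    set g := youngGerm W φ s t
    have k5 : ‖F t - F s‖ ≤ ‖g‖ + ‖D - g‖ + ‖D - (F t - F s)‖ := by
      calc ‖F t - F s‖ = ‖g + (D - g) + -(D - (F t - F s))‖ := by congr 1; abel
        _ ≤ ‖g‖ + ‖D - g‖ + ‖-(D - (F t - F s))‖ := norm_add₃_le
        _ = _ := by rw [norm_neg]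
    have : (A + M * (b - a) ^ (lam * γ)) * (t - s) ^ τ
      = A * (t - s) ^ τ + M * ((b - a) ^ (lam * γ) * (t - s) ^ τ) := by ring
    linarith
  refine ⟨A + M * (b - a) ^ (lam * γ), by positivity, fun s hs t ht => ?_⟩
  rcases lt_trichotomy s t with h | rfl | h
  · rw [abs_of_pos (by linarith)]
    exact main s t hs.1 h ht.2
  · simp [Real.zero_rpow hτ0.ne']
  · rw [norm_sub_rev, abs_sub_comm, abs_of_pos (by linarith)]
    exact main t s ht.1 h hs.2

end
end
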